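/- Let λ be a nonzero real number, let β, α be real numbers with β ≥ 1 and α > 1, and suppose α = 2βm + 1 for a positive integer m. Define, for y > 0, F(y) = (1/λ) · y^{1-2β-α}/(1-2β-α) + (λ^{2m+1}/Γ(2m+3)) · log y + ∑_{n=-m}^{-1} (λ^{2n+2m+1}/Γ(2n+2m+3)) · y^{2βn}/(2βn) + ∑_{n=0}^{∞} (λ^{2n+2m+3}/Γ(2n+2m+5)) · y^{2βn+2β}/(2βn+2β). Then for every x > 0, F is differentiable at x and F′(x) = cosh(λ x^β)/(λ x^{2β+α}). -/

import Mathlib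

open Real

/-- The `k`-th term of the cosine series for `cosh (l * z ^ β)`, divided by `l * z ^ γ`. -/
lemma cosh_series_term_div {l z : ℝ} (β γ : ℝ) (hz : 0 < z) (k : ℕ) :
    (l * z ^ β) ^ (2 * k) / ((2 * k).factorial : ℝ) / (l * z ^ γ) =
      l ^ (2 * k) / l / ((2 * k).factorial : ℝ) * z ^ (2 * β * k - γ) := by
  have h : (z ^ β) ^ (2 * k) = z ^ (2 * β * k) := by
    rw [← Real.rpow_natCast, ← Real.rpow_mul hz.le]
    congr 1
    push_cast
    ring
  rw [mul_pow, h, Real.rpow_sub hz]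
  ring

lemma hasSum_cosh_div (l β γ : ℝ) {z : ℝ} (hz : 0 < z) :
    HasSum (fun k : ℕ =>
      l ^ (2 * k) / l / ((2 * k).factorial : ℝ) * z ^ (2 * β * k - γ))
      (Real.cosh (l * z ^ β) / (l * z ^ γ)) := by
  simpa only [cosh_series_term_div β γ hz] using
    (Real.hasSum_cosh (l * z ^ β)).div_const (l * z ^ γ)

lemma hasDerivAt_rpow_div {x r : ℝ} (hx : 0 < x) (hr : r ≠ 0) :
    HasDerivAt (fun y : ℝ => y ^ r / r) (x ^ (r - 1)) x := by
  have h := (Real.hasDerivAt_rpow_const (p := r) (Or.inl hx.ne')).div_const r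
  rwa [mul_div_cancel_left₀ _ hr] at h

/-- Termwise differentiation of a generalized power series with exponents `e n ≥ 1`. -/
lemma hasDerivAt_tsum_rpow_div {c e : ℕ → ℝ} {x R : ℝ} (hx : 0 < x) (hxR : x < R)
    (he : ∀ n, 1 ≤ e n) (hs : Summable fun n => |c n| * R ^ (e n - 1)) :
    HasDerivAt (fun y : ℝ => ∑' n, c n * (y ^ e n / e n)) (∑' n, c n * x ^ (e n - 1)) x := by
  have hR : 0 < R := hx.trans hxR
  refine hasDerivAt_tsum_of_isPreconnected (𝕜 := ℝ) (F := ℝ)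
    (g := fun n y => c n * (y ^ e n / e n)) (g' := fun n y => c n * y ^ (e n - 1))
    (t := Set.Ioo 0 R) (y₀ := x) hs isOpen_Ioo
    isPreconnected_Ioo (fun n y hy => ?_) (fun n y hy => ?_) ⟨hx, hxR⟩ ?_ ⟨hx, hxR⟩
  · exact (hasDerivAt_rpow_div hy.1 (by linarith [he n])).const_mul _
  · rw [norm_mul, Real.norm_eq_abs, Real.norm_of_nonneg (Real.rpow_nonneg hy.1.le _)]
    exact mul_le_mul_of_nonneg_left
      (Real.rpow_le_rpow hy.1.le hy.2.le (by linarith [he n])) (abs_nonneg _)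
  · refine (hs.mul_right R).of_norm_bounded fun n => ?_
    have h0 : 0 ≤ x ^ e n := Real.rpow_nonneg hx.le _
    rw [norm_mul, Real.norm_eq_abs,
      Real.norm_of_nonneg (div_nonneg h0 (by linarith [he n])), mul_assoc]
    refine mul_le_mul_of_nonneg_left ?_ (abs_nonneg _)
    calc x ^ e n / e n ≤ x ^ e n := div_le_self h0 (he n)
      _ ≤ R ^ e n := Real.rpow_le_rpow hx.le hxR.le (by linarith [he n])
      _ = R ^ (e n - 1) * R := by rw [Real.rpow_sub_one hR.ne', div_mul_cancel₀ _ hR.ne']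

lemma sum_Icc_neg_eq_sum_range (m : ℕ) (f : ℤ → ℝ) :
    ∑ n ∈ Finset.Icc (-(m : ℤ)) (-1 : ℤ), f n = ∑ j ∈ Finset.range m, f ((j : ℤ) - m) := by
  symm
  refine Finset.sum_bij (fun j _ => (j : ℤ) - m) ?_ ?_ ?_ ?_
  · intro j hj
    rw [Finset.mem_range] at hj
    rw [Finset.mem_Icc]
    omega
  · intro a _ b _ h
    omega
  · intro b hb
    rw [Finset.mem_Icc] at hb
    exact ⟨(b + m).toNat, by rw [Finset.mem_range]; omega, by omega⟩
  · intros
    rfl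

/-- Theorem 4, case ε = 1 (hyperbolic cosine integral with `α = 2βm + 1`). -/
theorem cosh_integral_eps_one (lam β α : ℝ) (hlam : lam ≠ 0) (hβ : 1 ≤ β) (hα : 1 < α)
    (m : ℕ) (hm : 0 < m) (hαm : α = 2 * β * m + 1) :
    ∀ x : ℝ, 0 < x →
      HasDerivAt (fun y : ℝ =>
        (1 / lam) * (y ^ (1 - 2 * β - α) / (1 - 2 * β - α)) +
        (lam ^ (2 * m + 1) / Real.Gamma (2 * (m : ℝ) + 3)) * Real.log y +
        (∑ n ∈ Finset.Icc (-(m : ℤ)) (-1 : ℤ),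
          (lam ^ (2 * n + 2 * (m : ℤ) + 1) / Real.Gamma (2 * (n : ℝ) + 2 * (m : ℝ) + 3)) *
            (y ^ (2 * β * (n : ℝ)) / (2 * β * (n : ℝ)))) +
        ∑' n : ℕ,
          (lam ^ (2 * n + 2 * m + 3) / Real.Gamma (2 * (n : ℝ) + 2 * (m : ℝ) + 5)) *
            (y ^ (2 * β * (n : ℝ) + 2 * β) / (2 * β * (n : ℝ) + 2 * β)))
        (Real.cosh (lam * x ^ β) / (lam * x ^ (2 * β + α))) x := by
  intro x hx
  have hgamma (k : ℕ) (t : ℝ) (ht : t = 2 * (k : ℝ) + 1) :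
      Real.Gamma t = ((2 * k).factorial : ℝ) := by
    rw [ht, ← Real.Gamma_nat_eq_factorial]
    push_cast
    rfl
  have hpow (l : ℝ) (hl : l ≠ 0) (k : ℕ) : l ^ (2 * (k + 1)) / l = l ^ (2 * k + 1) := by
    rw [show 2 * (k + 1) = 2 * k + 1 + 1 by ring, pow_succ, mul_div_cancel_right₀ _ hl]
  set T : ℝ → ℝ → ℕ → ℝ := fun l z k =>
    l ^ (2 * k) / l / ((2 * k).factorial : ℝ) * z ^ (2 * β * k - (2 * β + α)) with hT
  have hcoef (n : ℕ) : Real.Gamma (2 * (n : ℝ) + 2 * (m : ℝ) + 5) =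
      ((2 * (n + (m + 2))).factorial : ℝ) :=
    hgamma _ _ (by push_cast; ring)
  have htail (l : ℝ) (hl : l ≠ 0) (z : ℝ) (n : ℕ) :
      l ^ (2 * n + 2 * m + 3) / Real.Gamma (2 * (n : ℝ) + 2 * (m : ℝ) + 5) *
        z ^ (2 * β * (n : ℝ) + 2 * β - 1) = T l z (n + (m + 2)) := by
    rw [hcoef, hT]
    dsimp only
    rw [show n + (m + 2) = n + m + 1 + 1 by ring, hpow l hl,
      show 2 * (n + m + 1) + 1 = 2 * n + 2 * m + 3 by ring]
    congr 2
    push_cast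
    rw [hαm]
    ring
  have hlead : HasDerivAt (fun y : ℝ => (1 / lam) * (y ^ (1 - 2 * β - α) / (1 - 2 * β - α)))
      (T lam x 0) x := by
    refine ((hasDerivAt_rpow_div hx (r := 1 - 2 * β - α) (by linarith)).const_mul
      (1 / lam)).congr_deriv ?_
    simp only [hT, mul_zero, pow_zero, Nat.factorial_zero, Nat.cast_one, div_one, Nat.cast_zero]
    congr 2
    ring
  have hlog : HasDerivAt
      (fun y : ℝ => (lam ^ (2 * m + 1) / Real.Gamma (2 * (m : ℝ) + 3)) * Real.log y)
      (T lam x (m + 1)) x := by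
    refine ((Real.hasDerivAt_log hx.ne').const_mul _).congr_deriv ?_
    rw [hgamma (m + 1) _ (by push_cast; ring), ← Real.rpow_neg_one, hT]
    dsimp only
    rw [hpow lam hlam]
    congr 2
    push_cast
    rw [hαm]
    ring
  have hfin : HasDerivAt (fun y : ℝ => ∑ n ∈ Finset.Icc (-(m : ℤ)) (-1 : ℤ),
      (lam ^ (2 * n + 2 * (m : ℤ) + 1) / Real.Gamma (2 * (n : ℝ) + 2 * (m : ℝ) + 3)) *
        (y ^ (2 * β * (n : ℝ)) / (2 * β * (n : ℝ))))
      (∑ j ∈ Finset.range m, T lam x (j + 1)) x := by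
    simp only [sum_Icc_neg_eq_sum_range]
    refine HasDerivAt.fun_sum fun j hj => ?_
    have hjm : (j : ℝ) < m := by exact_mod_cast Finset.mem_range.mp hj
    have hne : 2 * β * (((j : ℤ) - (m : ℤ) : ℤ) : ℝ) ≠ 0 := by
      push_cast
      exact mul_ne_zero (by linarith) (by linarith)
    refine ((hasDerivAt_rpow_div hx hne).const_mul _).congr_deriv ?_
    rw [hgamma (j + 1) _ (by push_cast; ring),
      show 2 * ((j : ℤ) - m) + 2 * (m : ℤ) + 1 = ((2 * j + 1 : ℕ) : ℤ) by push_cast; ring,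
      zpow_natCast, hT]
    dsimp only
    rw [hpow lam hlam]
    congr 2
    push_cast
    rw [hαm]
    ring
  have hser := hasDerivAt_tsum_rpow_div
    (c := fun n : ℕ => lam ^ (2 * n + 2 * m + 3) / Real.Gamma (2 * (n : ℝ) + 2 * (m : ℝ) + 5))
    (e := fun n : ℕ => 2 * β * (n : ℝ) + 2 * β) hx (lt_add_one x)
    (fun n => by
      have : 0 ≤ β * (n : ℝ) := by positivity
      linarith)
    (by
      have h := (summable_nat_add_iff (m + 2)).mpr
        (hasSum_cosh_div |lam| β (2 * β + α) (by linarith : 0 < x + 1)).summable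
      refine h.congr fun n => ?_
      rw [abs_div, abs_pow, abs_of_pos (Real.Gamma_pos_of_pos
        (by positivity : 0 < 2 * (n : ℝ) + 2 * (m : ℝ) + 5))]
      exact (htail |lam| (abs_ne_zero.mpr hlam) (x + 1) n).symm)
  have hsum := hasSum_cosh_div lam β (2 * β + α) hx
  refine (((hlead.fun_add hlog).fun_add hfin).fun_add hser).congr_deriv ?_
  symm
  rw [← hsum.tsum_eq, ← hsum.summable.sum_add_tsum_nat_add (m + 2), Finset.sum_range_succ,
    Finset.sum_range_succ']
  simp only [htail lam hlam x]
  simp only [hT]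
  ring
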